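/- arXiv:2102.05314 — 3 statements merged into one kernel-verified Lean document; each statement's English description precedes it below -/
import Mathlib

section
/- Let W0 ∈ ℝ^{n×K} and H0 ∈ ℝ^{K×p} be nonnegative matrices such that W0 has rank K and H0 has linearly independent rows, and set X0 = W0 H0. Then the following are equivalent: (i) for every pair of nonnegative matrices W ∈ ℝ^{n×K} of rank K and H ∈ ℝ^{K×p} with linearly independent rows such that W H = X0, one has (W,H) ≡ (W0,H0); (ii) the nonnegative orthant {x ∈ ℝ^K : x ≥ 0 entrywise} is the only K-simplicial cone C satisfying Cone(W0) ⊆ C ⊆ D(H0). -/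
open Matrix

noncomputable section

/-- Squared Frobenius norm `‖A‖_F²`. -/
def frobSq {m p : ℕ} (A : Matrix (Fin m) (Fin p) ℝ) : ℝ := ∑ i, ∑ j, (A i j) ^ 2

/-- Frobenius norm `‖A‖_F`. -/
def frobNorm {m p : ℕ} (A : Matrix (Fin m) (Fin p) ℝ) : ℝ := Real.sqrt (frobSq A)

/-- Euclidean norm `‖v‖₂` of a vector. -/
def eNorm {m : ℕ} (v : Fin m → ℝ) : ℝ := Real.sqrt (∑ i, (v i) ^ 2)

/-- Entrywise nonnegative matrix. -/
def Nonneg {m K : ℕ} (A : Matrix (Fin m) (Fin K) ℝ) : Prop := ∀ i k, 0 ≤ A i k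

/-- Row-stochastic matrix: nonnegative with unit row sums. -/
def RowStochastic {m K : ℕ} (W : Matrix (Fin m) (Fin K) ℝ) : Prop :=
  Nonneg W ∧ ∀ i, ∑ k, W i k = 1

/-- Cone generated by the rows of `W`. -/
def coneRows {m K : ℕ} (W : Matrix (Fin m) (Fin K) ℝ) : Set (Fin K → ℝ) :=
  {x | ∃ c : Fin m → ℝ, (∀ i, 0 ≤ c i) ∧ x = ∑ i, c i • W i}

/-- Dual cone of the columns of `H`: `{x | xᵀ H ≥ 0}`. -/
def dualConeCols {K q : ℕ} (H : Matrix (Fin K) (Fin q) ℝ) : Set (Fin K → ℝ) :=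
  {x | ∀ j, 0 ≤ ∑ k, x k * H k j}

/-- A `K`-simplicial cone: the cone generated by `K` linearly independent vectors of `ℝ^K`. -/
def IsSimplicialCone {K : ℕ} (C : Set (Fin K → ℝ)) : Prop :=
  ∃ B : Matrix (Fin K) (Fin K) ℝ, LinearIndependent ℝ (fun k => B k) ∧ C = coneRows B

/-- The nonnegative orthant of `ℝ^K`. -/
def nonnegOrthant (K : ℕ) : Set (Fin K → ℝ) := {x | ∀ k, 0 ≤ x k}

/-- `(W, H) ≡ (W0, H0)`: equality up to permutation and positive scaling of the
columns of `W` (resp. rows of `H`). -/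
def EquivScalePerm {n K p : ℕ} (W W0 : Matrix (Fin n) (Fin K) ℝ)
    (H H0 : Matrix (Fin K) (Fin p) ℝ) : Prop :=
  ∃ σ : Equiv.Perm (Fin K), ∃ d : Fin K → ℝ, (∀ k, 0 < d k) ∧
    (∀ i k, W i k = d k * W0 i (σ k)) ∧ (∀ k j, H k j = (d k)⁻¹ * H0 (σ k) j)

theorem mem_coneRows_iff {m K : ℕ} {B : Matrix (Fin m) (Fin K) ℝ} {x : Fin K → ℝ} :
    x ∈ coneRows B ↔ ∃ c : Fin m → ℝ, (∀ i, 0 ≤ c i) ∧ x = c ᵥ* B := by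
  simp only [coneRows, Set.mem_ofPred_eq, vecMul_eq_sum]

theorem row_mem_coneRows {m K : ℕ} (B : Matrix (Fin m) (Fin K) ℝ) (i : Fin m) :
    B i ∈ coneRows B := by
  refine mem_coneRows_iff.2 ⟨Pi.single i 1, fun j => ?_, (single_one_vecMul i B).symm⟩
  by_cases h : j = i
  · subst h; simp
  · simp [h]

/-- If the rows of `A` lie in the cone generated by the rows of `B`, then `A` factors through `B`
with nonnegative coefficients. -/
theorem exists_nonneg_mul_of_rows_mem {m n K : ℕ} {A : Matrix (Fin n) (Fin K) ℝ}
    {B : Matrix (Fin m) (Fin K) ℝ} (h : ∀ i, A i ∈ coneRows B) :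
    ∃ W : Matrix (Fin n) (Fin m) ℝ, Nonneg W ∧ A = W * B := by
  choose c hc hA using fun i => mem_coneRows_iff.1 (h i)
  refine ⟨Matrix.of c, hc, ?_⟩
  ext i j
  rw [hA i]
  rfl

theorem coneRows_mul_subset {m n K : ℕ} {W : Matrix (Fin n) (Fin m) ℝ} (hW : Nonneg W)
    (B : Matrix (Fin m) (Fin K) ℝ) : coneRows (W * B) ⊆ coneRows B := by
  intro x hx
  obtain ⟨c, hc, rfl⟩ := mem_coneRows_iff.1 hx
  refine mem_coneRows_iff.2 ⟨c ᵥ* W, fun k => ?_, (vecMul_vecMul c W B).symm⟩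
  rw [vecMul_eq_sum, Finset.sum_apply]
  exact Finset.sum_nonneg fun i _ => mul_nonneg (hc i) (hW i k)

theorem coneRows_subset_dualConeCols_iff {m K p : ℕ} (B : Matrix (Fin m) (Fin K) ℝ)
    (H : Matrix (Fin K) (Fin p) ℝ) : coneRows B ⊆ dualConeCols H ↔ Nonneg (B * H) := by
  refine ⟨fun h i j => h (row_mem_coneRows B i) j, fun h x hx j => ?_⟩
  obtain ⟨c, hc, rfl⟩ := mem_coneRows_iff.1 hx
  change 0 ≤ ((c ᵥ* B) ᵥ* H) j
  rw [vecMul_vecMul, vecMul_eq_sum, Finset.sum_apply]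
  exact Finset.sum_nonneg fun i _ => mul_nonneg (hc i) (h i j)

theorem coneRows_one (K : ℕ) :
    coneRows (1 : Matrix (Fin K) (Fin K) ℝ) = nonnegOrthant K := by
  ext x
  simp [mem_coneRows_iff, nonnegOrthant]

/-- A nonnegative matrix with a nonnegative inverse is monomial. -/
theorem exists_perm_of_nonneg_inverse {K : ℕ} {B M : Matrix (Fin K) (Fin K) ℝ}
    (hB : Nonneg B) (hM : Nonneg M) (hBM : B * M = 1) :
    ∃ σ : Equiv.Perm (Fin K), ∃ d : Fin K → ℝ, (∀ k, 0 < d k) ∧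
      ∀ k j, B k j = if j = σ k then (d k)⁻¹ else 0 := by
  have hpos : ∀ k, ∃ j, 0 < B k j * M j k := fun k => by
    by_contra! h
    have h1 : (B * M) k k = 1 := by simp [hBM]
    have h2 : (B * M) k k ≤ 0 := by
      rw [mul_apply]
      exact Finset.sum_nonpos fun j _ => h j
    linarith
  choose σ hσ using hpos
  have hzero : ∀ l k, l ≠ k → B l (σ k) = 0 := fun l k hlk => by
    have h0 : ∑ j, B l j * M j k = 0 := by
      have := congrFun (congrFun hBM l) k
      rwa [one_apply_ne hlk] at this
    have h1 := (Finset.sum_eq_zero_iff_of_nonneg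
      fun j _ => mul_nonneg (hB l j) (hM j k)).1 h0 (σ k) (Finset.mem_univ _)
    exact (mul_eq_zero.1 h1).resolve_right (right_ne_zero_of_mul (hσ k).ne')
  have hBσ : ∀ k, 0 < B k (σ k) := fun k =>
    (hB k _).lt_of_ne' (left_ne_zero_of_mul (hσ k).ne')
  have hinj : Function.Injective σ := fun k l hkl => by
    by_contra hne
    have := hzero k l hne
    rw [← hkl] at this
    exact (hBσ k).ne' this
  refine ⟨Equiv.ofBijective σ (Finite.injective_iff_bijective.1 hinj),
    fun k => (B k (σ k))⁻¹, fun k => inv_pos.2 (hBσ k), fun k j => ?_⟩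
  obtain ⟨l, rfl⟩ := (Finite.injective_iff_surjective.1 hinj) j
  by_cases hlk : l = k
  · simp [hlk]
  · simp [hinj.eq_iff, hlk, hzero k l (Ne.symm hlk)]

theorem coneRows_eq_nonnegOrthant_iff {K : ℕ} {B : Matrix (Fin K) (Fin K) ℝ} :
    coneRows B = nonnegOrthant K ↔ ∃ σ : Equiv.Perm (Fin K), ∃ d : Fin K → ℝ,
      (∀ k, 0 < d k) ∧ ∀ k j, B k j = if j = σ k then (d k)⁻¹ else 0 := by
  constructor
  · intro h
    have hB : Nonneg B := fun k => by
      have := row_mem_coneRows B k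
      rwa [h] at this
    obtain ⟨M, hM, hMB⟩ := exists_nonneg_mul_of_rows_mem (A := 1) (B := B) fun i => by
      rw [h, ← coneRows_one]
      exact row_mem_coneRows 1 i
    exact exists_perm_of_nonneg_inverse hB hM (mul_eq_one_comm.1 hMB.symm)
  · rintro ⟨σ, d, hd, hB⟩
    have hBn : Nonneg B := fun k j => by
      rw [hB]
      split_ifs
      exacts [(inv_pos.2 (hd k)).le, le_rfl]
    let M : Matrix (Fin K) (Fin K) ℝ := Matrix.of fun j k => if j = σ k then d k else 0
    have hM : Nonneg M := fun j k => by
      change 0 ≤ if j = σ k then d k else 0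
      split_ifs
      exacts [(hd k).le, le_rfl]
    have hBM : B * M = 1 := by
      ext k l
      by_cases hkl : k = l
      · subst hkl; simp [mul_apply, hB, M, (hd k).ne']
      · simp [mul_apply, hB, M, hkl, Ne.symm hkl]
    rw [← coneRows_one]
    refine Set.Subset.antisymm ?_ ?_
    · simpa only [Matrix.mul_one] using coneRows_mul_subset hBn (1 : Matrix (Fin K) (Fin K) ℝ)
    · simpa [mul_eq_one_comm.1 hBM] using coneRows_mul_subset hM B

theorem exists_left_inverse_of_rank_eq {n K : ℕ} {W : Matrix (Fin n) (Fin K) ℝ}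
    (hW : W.rank = K) : ∃ L : Matrix (Fin K) (Fin n) ℝ, L * W = 1 := by
  refine vecMul_surjective_iff_exists_left_inverse.1 ?_
  have htop : LinearMap.range Wᵀ.mulVecLin = ⊤ := by
    refine Submodule.eq_top_of_finrank_eq ?_
    change Wᵀ.rank = _
    rw [rank_transpose, hW, Module.finrank_fin_fun]
  intro y
  obtain ⟨x, hx⟩ := LinearMap.range_eq_top.1 htop y
  exact ⟨x, by simpa [mulVec_transpose] using hx⟩

theorem mul_right_cancel_of_linearIndependent {m K p : ℕ} {A B : Matrix (Fin m) (Fin K) ℝ}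
    {H : Matrix (Fin K) (Fin p) ℝ} (hH : LinearIndependent ℝ (fun k => H k))
    (h : A * H = B * H) : A = B := by
  funext i
  exact vecMul_injective_iff.2 hH (congrFun h i)

theorem isUnit_of_linearIndependent_mul {K p : ℕ} {A : Matrix (Fin K) (Fin K) ℝ}
    {H : Matrix (Fin K) (Fin p) ℝ} (h : LinearIndependent ℝ (fun k => (A * H) k)) :
    IsUnit A := by
  refine vecMul_injective_iff_isUnit.1 fun x y hxy => vecMul_injective_iff.2 h ?_
  change x ᵥ* (A * H) = y ᵥ* (A * H)
  rw [← vecMul_vecMul, ← vecMul_vecMul]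
  exact congrArg (· ᵥ* H) hxy

theorem linearIndependent_rows_mul_of_isUnit {K p : ℕ} {A : Matrix (Fin K) (Fin K) ℝ}
    {H : Matrix (Fin K) (Fin p) ℝ} (hA : IsUnit A) (hH : LinearIndependent ℝ (fun k => H k)) :
    LinearIndependent ℝ (fun k => (A * H) k) := by
  refine vecMul_injective_iff.1 fun x y hxy => ?_
  refine vecMul_injective_of_isUnit hA (vecMul_injective_iff.2 hH ?_)
  simpa only [vecMul_vecMul] using hxy

/-- uniqueness of an NMF decomposition (Thomas' theorem):
(i) every nonnegative factorization of `X0 = W0 H0` coincides with `(W0, H0)` up to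
permutation and positive scaling, iff (ii) the nonnegative orthant is the only
`K`-simplicial cone `C` with `Cone(W0) ⊆ C ⊆ D(H0)`. -/
theorem stmt0 {n K p : ℕ} (W0 : Matrix (Fin n) (Fin K) ℝ) (H0 : Matrix (Fin K) (Fin p) ℝ)
    (hW0 : Nonneg W0) (hH0 : Nonneg H0)
    (hW0rank : W0.rank = K) (hH0li : LinearIndependent ℝ (fun k => H0 k)) :
    (∀ (W : Matrix (Fin n) (Fin K) ℝ) (H : Matrix (Fin K) (Fin p) ℝ),
        Nonneg W → Nonneg H → W.rank = K → LinearIndependent ℝ (fun k => H k) →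
        W * H = W0 * H0 → EquivScalePerm W W0 H H0) ↔
      (∀ C : Set (Fin K → ℝ), IsSimplicialCone C → coneRows W0 ⊆ C →
        C ⊆ dualConeCols H0 → C = nonnegOrthant K) := by
  constructor
  · rintro h C ⟨B, hBli, rfl⟩ hWC hCH
    have hBunit : IsUnit B := linearIndependent_rows_iff_isUnit.1 hBli
    obtain ⟨W, hW, hWB⟩ := exists_nonneg_mul_of_rows_mem fun i => hWC (row_mem_coneRows W0 i)
    have hrank : W.rank = K := by
      refine le_antisymm (rank_le_width W) ?_
      calc K = (W * B).rank := by rw [← hWB, hW0rank]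
        _ ≤ W.rank := rank_mul_le_left W B
    obtain ⟨σ, d, hd, -, hH⟩ := h W (B * H0) hW
      ((coneRows_subset_dualConeCols_iff B H0).1 hCH) hrank
      (linearIndependent_rows_mul_of_isUnit hBunit hH0li) (by rw [← Matrix.mul_assoc, ← hWB])
    refine coneRows_eq_nonnegOrthant_iff.2 ⟨σ, d, hd, fun k j => ?_⟩
    have hB : B = Matrix.of fun k j => if j = σ k then (d k)⁻¹ else 0 := by
      refine mul_right_cancel_of_linearIndependent hH0li ?_
      ext k j
      rw [hH]
      simp [mul_apply]
    exact congrFun (congrFun hB k) j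
  · intro h W H hW hH _ hHli hWH
    obtain ⟨L, hL⟩ := exists_left_inverse_of_rank_eq hW0rank
    have hH0 : H0 = L * W * H := by
      rw [Matrix.mul_assoc, hWH, ← Matrix.mul_assoc, hL, Matrix.one_mul]
    have hA : IsUnit (L * W) := isUnit_of_linearIndependent_mul (H := H) (hH0 ▸ hH0li)
    obtain ⟨B, hAB⟩ := isUnit_iff_exists_inv.1 hA
    have hBA := mul_eq_one_comm.1 hAB
    have hHB : H = B * H0 := by
      rw [hH0, ← Matrix.mul_assoc, hBA, Matrix.one_mul]
    have hWB : W * B = W0 := by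
      refine mul_right_cancel_of_linearIndependent hH0li ?_
      rw [Matrix.mul_assoc, ← hHB, hWH]
    have hBli : LinearIndependent ℝ (fun k => B k) :=
      linearIndependent_rows_iff_isUnit.2 (isUnit_iff_exists_inv.2 ⟨_, hBA⟩)
    obtain ⟨σ, d, hd, hB⟩ := coneRows_eq_nonnegOrthant_iff.1 <|
      h (coneRows B) ⟨B, hBli, rfl⟩ (hWB ▸ coneRows_mul_subset hW B)
        ((coneRows_subset_dualConeCols_iff B H0).2 (hHB ▸ hH))
    refine ⟨σ, d, hd, fun i k => ?_, fun k j => ?_⟩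
    · rw [← hWB]
      have := (hd k).ne'
      simp only [mul_apply, hB, mul_ite, mul_zero, Equiv.apply_eq_iff_eq,
        Finset.sum_ite_eq, Finset.mem_univ, if_true]
      field_simp
    · simp [hHB, mul_apply, hB]
end
end

section
/- There exists an absolute constant c > 0 with the following property. Let X0 = W0 H0 with W0 ∈ ℝ^{n×K} row-stochastic and H0 ∈ ℝ^{K×p}, assume the convex hull of the rows of T_train(X0) has internal radius μ > 0 (in dimension K−1) with some center z0, let E ∈ ℝ^{n×p} satisfy T(E) = E and ‖E‖_F ≤ Δ for some Δ > 0, and set X = T(X0) + E. If Ĥ ∈ ℝ^{K×p} minimizes H ↦ D̃(H, X) over the set {H ∈ ℝ^{K×p} : D̄(X, H) ≤ Δ²}, then D̃(Ĥ, X0)^{1/2} ≤ D̃(H0, X0)^{1/2} + c √K ‖E‖_F. -/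
open Matrix

noncomputable section

/-- The mask operator `T` zeroing the bottom-right `N × F` block. -/
def maskT (n N p F : ℕ) (M : Matrix (Fin n) (Fin p) ℝ) : Matrix (Fin n) (Fin p) ℝ :=
  Matrix.of fun i j => if (i : ℕ) < n - N ∨ (j : ℕ) < p - F then M i j else 0

/-- The convex hull of the rows of `A` has internal radius `μ` (in dimension `K − 1`)
with center `z0`. -/
def HasInternalRadius {m p : ℕ} (A : Matrix (Fin m) (Fin p) ℝ) (K : ℕ) (μ : ℝ)
    (z0 : Fin p → ℝ) : Prop :=
  ∃ U : Matrix (Fin p) (Fin (K - 1)) ℝ, Uᵀ * U = 1 ∧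
    ∀ y : Fin (K - 1) → ℝ, eNorm y ≤ μ →
      z0 + U.mulVec y ∈ convexHull ℝ (Set.range fun i => A i)

/-- `D(A, B)`: squared distance from the rows of `A` to the convex hull of the rows of `B`. -/
def Ddiv {m q p : ℕ} (A : Matrix (Fin m) (Fin p) ℝ) (B : Matrix (Fin q) (Fin p) ℝ) : ℝ :=
  sInf {t : ℝ | ∃ C : Matrix (Fin m) (Fin q) ℝ, RowStochastic C ∧ t = frobSq (A - C * B)}

/-- `D̃(A, B)`: as `D(A, B)` but minimizing also over completions `M` of `B` off the mask. -/
def Dtilde (n N p F : ℕ) {m : ℕ} (A : Matrix (Fin m) (Fin p) ℝ)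
    (B : Matrix (Fin n) (Fin p) ℝ) : ℝ :=
  sInf {t : ℝ | ∃ (C : Matrix (Fin m) (Fin n) ℝ) (M : Matrix (Fin n) (Fin p) ℝ),
    RowStochastic C ∧ maskT n N p F (M - B) = 0 ∧ t = frobSq (A - C * M)}

/-- `D̄(X, H) = inf {‖T(X − W H)‖_F² : W row-stochastic}`. -/
def Dbar (n N p F : ℕ) {K : ℕ} (X : Matrix (Fin n) (Fin p) ℝ)
    (H : Matrix (Fin K) (Fin p) ℝ) : ℝ :=
  sInf {t : ℝ | ∃ W : Matrix (Fin n) (Fin K) ℝ, RowStochastic W ∧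
    t = frobSq (maskT n N p F (X - W * H))}

section FrobeniusNorm

open scoped Matrix.Norms.Frobenius

theorem frobNorm_eq_norm {m p : ℕ} (A : Matrix (Fin m) (Fin p) ℝ) : frobNorm A = ‖A‖ := by
  simp [frobNorm, frobSq, Matrix.frobenius_norm_def, Real.sqrt_eq_rpow]

theorem frobNorm_add_le {m p : ℕ} (A B : Matrix (Fin m) (Fin p) ℝ) :
    frobNorm (A + B) ≤ frobNorm A + frobNorm B := by
  simpa only [frobNorm_eq_norm] using norm_add_le A B

theorem frobNorm_neg {m p : ℕ} (A : Matrix (Fin m) (Fin p) ℝ) : frobNorm (-A) = frobNorm A := by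
  simp only [frobNorm_eq_norm, norm_neg]

theorem frobNorm_mul_le {m n p : ℕ} (A : Matrix (Fin m) (Fin n) ℝ)
    (B : Matrix (Fin n) (Fin p) ℝ) : frobNorm (A * B) ≤ frobNorm A * frobNorm B := by
  simpa only [frobNorm_eq_norm] using Matrix.frobenius_norm_mul A B

end FrobeniusNorm

theorem frobSq_nonneg {m p : ℕ} (A : Matrix (Fin m) (Fin p) ℝ) : 0 ≤ frobSq A :=
  Finset.sum_nonneg fun _ _ => Finset.sum_nonneg fun _ _ => sq_nonneg _

theorem frobNorm_nonneg {m p : ℕ} (A : Matrix (Fin m) (Fin p) ℝ) : 0 ≤ frobNorm A :=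
  Real.sqrt_nonneg _

theorem frobNorm_le_of_rowStochastic {m n : ℕ} {C : Matrix (Fin m) (Fin n) ℝ}
    (hC : RowStochastic C) : frobNorm C ≤ Real.sqrt m := by
  refine Real.sqrt_le_sqrt ?_
  calc frobSq C ≤ ∑ _i : Fin m, (1 : ℝ) := by
        refine Finset.sum_le_sum fun i _ => ?_
        calc ∑ j, C i j ^ 2 ≤ (∑ j, C i j) ^ 2 :=
              Finset.sum_sq_le_sq_sum_of_nonneg fun j _ => hC.1 i j
          _ = 1 := by rw [hC.2 i, one_pow]
    _ = m := by simp

theorem exists_rowStochastic (m : ℕ) {n : ℕ} (hn : 0 < n) :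
    ∃ C : Matrix (Fin m) (Fin n) ℝ, RowStochastic C := by
  refine ⟨Matrix.of fun _ j => if j = ⟨0, hn⟩ then 1 else 0, fun i k => ?_, fun i => ?_⟩
  · simp only [Matrix.of_apply]
    split_ifs <;> norm_num
  · simp

theorem maskT_add (n N p F : ℕ) (A B : Matrix (Fin n) (Fin p) ℝ) :
    maskT n N p F (A + B) = maskT n N p F A + maskT n N p F B := by
  ext i j
  simp only [maskT, Matrix.of_apply, Matrix.add_apply]
  split_ifs <;> simp

theorem maskT_neg (n N p F : ℕ) (A : Matrix (Fin n) (Fin p) ℝ) :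
    maskT n N p F (-A) = -maskT n N p F A := by
  ext i j
  simp only [maskT, Matrix.of_apply, Matrix.neg_apply]
  split_ifs <;> simp

theorem maskT_sub (n N p F : ℕ) (A B : Matrix (Fin n) (Fin p) ℝ) :
    maskT n N p F (A - B) = maskT n N p F A - maskT n N p F B := by
  rw [sub_eq_add_neg, maskT_add, maskT_neg, ← sub_eq_add_neg]

theorem maskT_maskT (n N p F : ℕ) (A : Matrix (Fin n) (Fin p) ℝ) :
    maskT n N p F (maskT n N p F A) = maskT n N p F A := by
  ext i j
  simp only [maskT, Matrix.of_apply]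
  split_ifs <;> rfl

theorem Dbar_le {n N p F K : ℕ} {X : Matrix (Fin n) (Fin p) ℝ} {H : Matrix (Fin K) (Fin p) ℝ}
    {W : Matrix (Fin n) (Fin K) ℝ} (hW : RowStochastic W) :
    Dbar n N p F X H ≤ frobSq (maskT n N p F (X - W * H)) := by
  refine csInf_le ⟨0, ?_⟩ ⟨W, hW, rfl⟩
  rintro _ ⟨_, _, rfl⟩
  exact frobSq_nonneg _

theorem Dtilde_le {n N p F m : ℕ} {A : Matrix (Fin m) (Fin p) ℝ} {B M : Matrix (Fin n) (Fin p) ℝ}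
    {C : Matrix (Fin m) (Fin n) ℝ} (hC : RowStochastic C) (hM : maskT n N p F (M - B) = 0) :
    Dtilde n N p F A B ≤ frobSq (A - C * M) := by
  refine csInf_le ⟨0, ?_⟩ ⟨C, M, hC, hM, rfl⟩
  rintro _ ⟨_, _, _, _, rfl⟩
  exact frobSq_nonneg _

/-- `D̃(A, ·)^{1/2}` is Lipschitz with constant `√m`, where `m` is the number of rows of `A`. -/
theorem sqrt_Dtilde_le_add {n N p F m : ℕ} (hn : 0 < n) (A : Matrix (Fin m) (Fin p) ℝ)
    {B B' E : Matrix (Fin n) (Fin p) ℝ} (hE : maskT n N p F (B + E - B') = 0) :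
    Real.sqrt (Dtilde n N p F A B') ≤
      Real.sqrt (Dtilde n N p F A B) + Real.sqrt m * frobNorm E := by
  rw [← sub_le_iff_le_add]
  set a := Real.sqrt (Dtilde n N p F A B') - Real.sqrt m * frobNorm E with ha
  rcases le_or_gt a 0 with h0 | h0
  · exact h0.trans (Real.sqrt_nonneg _)
  refine Real.le_sqrt_of_sq_le (le_csInf ?_ ?_)
  · obtain ⟨C, hC⟩ := exists_rowStochastic m hn
    exact ⟨_, C, B, hC, by ext; simp [maskT], rfl⟩
  · rintro _ ⟨C, M, hC, hM, rfl⟩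
    rw [← Real.le_sqrt' h0]
    have hM' : maskT n N p F (M + E - B') = 0 := by
      rw [show M + E - B' = (M - B) + (B + E - B') by abel, maskT_add, hM, hE, add_zero]
    have h1 : Real.sqrt (Dtilde n N p F A B') ≤ frobNorm (A - C * (M + E)) :=
      Real.sqrt_le_sqrt (Dtilde_le hC hM')
    have h2 : frobNorm (A - C * (M + E)) ≤ frobNorm (A - C * M) + frobNorm (C * E) := by
      rw [show A - C * (M + E) = (A - C * M) + -(C * E) by rw [Matrix.mul_add]; abel,
        ← frobNorm_neg (C * E)]
      exact frobNorm_add_le _ _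
    have h3 : frobNorm (C * E) ≤ Real.sqrt m * frobNorm E :=
      (frobNorm_mul_le C E).trans
        (mul_le_mul_of_nonneg_right (frobNorm_le_of_rowStochastic hC) (frobNorm_nonneg E))
    change a ≤ frobNorm (A - C * M)
    linarith

/-- adapted Lemma B.5, `D̃(Ĥ, X0)^{1/2} ≤ D̃(H0, X0)^{1/2} + c √K ‖E‖_F`. -/
theorem stmt8 : ∃ c : ℝ, 0 < c ∧
    ∀ (n N p F K : ℕ), 1 ≤ N → N < n → 1 ≤ F → F < p →
    ∀ (W0 : Matrix (Fin n) (Fin K) ℝ) (H0 : Matrix (Fin K) (Fin p) ℝ),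
      RowStochastic W0 →
    ∀ X0 : Matrix (Fin n) (Fin p) ℝ, X0 = W0 * H0 →
    ∀ (μ : ℝ), 0 < μ → ∀ z0 : Fin p → ℝ,
      HasInternalRadius (X0.submatrix (Fin.castLE (Nat.sub_le n N)) id) K μ z0 →
    ∀ E : Matrix (Fin n) (Fin p) ℝ, maskT n N p F E = E →
    ∀ Δ : ℝ, 0 < Δ → frobNorm E ≤ Δ →
    ∀ Hh : Matrix (Fin K) (Fin p) ℝ,
      Dbar n N p F (maskT n N p F X0 + E) Hh ≤ Δ ^ 2 →
      (∀ H : Matrix (Fin K) (Fin p) ℝ, Dbar n N p F (maskT n N p F X0 + E) H ≤ Δ ^ 2 →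
        Dtilde n N p F Hh (maskT n N p F X0 + E) ≤ Dtilde n N p F H (maskT n N p F X0 + E)) →
      Real.sqrt (Dtilde n N p F Hh X0) ≤
        Real.sqrt (Dtilde n N p F H0 X0) + c * Real.sqrt K * frobNorm E := by
  refine ⟨2, two_pos, ?_⟩
  intro n N p F K _ hNn _ _ W0 H0 hW0 X0 hX0 _ _ _ _ E hE Δ _ hEΔ Hh _ hmin
  have hn : 0 < n := by omega
  have hfeas : Dbar n N p F (maskT n N p F X0 + E) H0 ≤ Δ ^ 2 := by
    refine (Dbar_le hW0).trans ?_
    rw [← hX0, maskT_sub, maskT_add, maskT_maskT, hE, add_sub_cancel_left,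
      ← Real.sq_sqrt (frobSq_nonneg E)]
    exact pow_le_pow_left₀ (frobNorm_nonneg E) hEΔ 2
  have h1 := Real.sqrt_le_sqrt (hmin H0 hfeas)
  have h2 : Real.sqrt (Dtilde n N p F H0 (maskT n N p F X0 + E)) ≤
      Real.sqrt (Dtilde n N p F H0 X0) + Real.sqrt K * frobNorm E := by
    refine sqrt_Dtilde_le_add hn H0 ?_
    rw [maskT_sub, maskT_add, maskT_add, maskT_maskT, sub_self]
  have h3 : Real.sqrt (Dtilde n N p F Hh X0) ≤
      Real.sqrt (Dtilde n N p F Hh (maskT n N p F X0 + E)) + Real.sqrt K * frobNorm E := by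
    rw [← frobNorm_neg E]
    refine sqrt_Dtilde_le_add hn Hh ?_
    rw [maskT_sub, maskT_add, maskT_add, maskT_neg, maskT_maskT, add_neg_cancel_right, sub_self]
  linarith
end
end

section
/- Let X ∈ ℝ^{n×p} and suppose (W, H, N) minimizes (W', H', N') ↦ ‖N' − W' H'‖_F² over the feasible set {(W', H', N') : W' ∈ ℝ^{n×K} row-stochastic, H' ∈ ℝ^{K×p} nonnegative, N' ∈ ℝ^{n×p} with T(N') = X}. Set G := (W H − N) Hᵀ ∈ ℝ^{n×K}. Then for every row index i and all column indices k, k': if W_{ik} > 0 and W_{ik'} > 0 then G_{ik} = G_{ik'}, and if W_{ik} > 0 and W_{ik'} = 0 then G_{ik'} ≥ G_{ik}. -/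
open Matrix

noncomputable section

theorem frobSq_eq_trace {m p : ℕ} (A : Matrix (Fin m) (Fin p) ℝ) :
    frobSq A = (A * Aᵀ).trace := by
  simp [frobSq, trace, mul_apply, sq]

theorem frobSq_sub_smul {m p : ℕ} (A B : Matrix (Fin m) (Fin p) ℝ) (t : ℝ) :
    frobSq (A - t • B) = frobSq A - 2 * t * (A * Bᵀ).trace + t ^ 2 * frobSq B := by
  have h : (B * Aᵀ).trace = (A * Bᵀ).trace := by
    rw [← trace_transpose, transpose_mul, transpose_transpose]
  simp only [frobSq_eq_trace, transpose_sub, transpose_smul, Matrix.sub_mul, Matrix.mul_sub,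
    trace_sub, Matrix.smul_mul, Matrix.mul_smul, trace_smul, smul_eq_mul, h]
  ring

/-- Moving mass `t` from entry `(i, k)` to entry `(i, k')` preserves row-stochasticity. -/
theorem RowStochastic.transfer {m K : ℕ} {W : Matrix (Fin m) (Fin K) ℝ} (hW : RowStochastic W)
    (i : Fin m) (k k' : Fin K) {t : ℝ} (ht : 0 ≤ t) (htW : t ≤ W i k) :
    RowStochastic (W + t • (single i k' 1 - single i k 1) : Matrix (Fin m) (Fin K) ℝ) := by
  refine ⟨fun a b => ?_, fun a => ?_⟩
  · have hab := hW.1 a b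
    simp only [Matrix.add_apply, Matrix.smul_apply, Matrix.sub_apply, single_apply, smul_eq_mul]
    by_cases hk : i = a ∧ k = b
    · obtain ⟨rfl, rfl⟩ := hk
      split_ifs <;> simp_all
    · split_ifs <;> simp <;> linarith
  · simp only [Matrix.add_apply, Matrix.smul_apply, Matrix.sub_apply, smul_eq_mul, Finset.sum_add_distrib,
      ← Finset.mul_sum, Finset.sum_sub_distrib, hW.2 a]
    by_cases h : i = a <;> simp [single_apply, h]

theorem nonneg_of_forall_small_quadratic_nonneg {a c w : ℝ} (hw : 0 < w)
    (h : ∀ t, 0 < t → t ≤ w → 0 ≤ t * a + t ^ 2 * c) : 0 ≤ a := by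
  by_contra! ha
  have hc : 0 < |c| + 1 := by positivity
  have ht : 0 < min w (-a / (|c| + 1)) := lt_min hw (div_pos (neg_pos.2 ha) hc)
  have hq := h _ ht (min_le_left _ _)
  have hle := (le_div_iff₀ hc).1 (min_le_right w (-a / (|c| + 1)))
  generalize min w (-a / (|c| + 1)) = t at *
  nlinarith [mul_le_mul_of_nonneg_left (le_abs_self c) (sq_nonneg t), mul_pos ht ht]

/-- First-order optimality of `W` over row-stochastic matrices: the gradient of the least-squares
objective is minimal along each row at the support of `W`. -/
theorem gradient_le_of_isMin {n p K : ℕ} {W : Matrix (Fin n) (Fin K) ℝ}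
    {H : Matrix (Fin K) (Fin p) ℝ} {M : Matrix (Fin n) (Fin p) ℝ} (hW : RowStochastic W)
    (hmin : ∀ W', RowStochastic W' → frobSq (M - W * H) ≤ frobSq (M - W' * H))
    {i : Fin n} {k : Fin K} (hk : 0 < W i k) (k' : Fin K) :
    ((W * H - M) * Hᵀ) i k ≤ ((W * H - M) * Hᵀ) i k' := by
  set D : Matrix (Fin n) (Fin K) ℝ := single i k' 1 - single i k 1 with hD
  have htr : ((M - W * H) * (D * H)ᵀ).trace =
      ((W * H - M) * Hᵀ) i k - ((W * H - M) * Hᵀ) i k' := by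
    rw [transpose_mul, ← Matrix.mul_assoc, ← neg_sub (W * H) M, Matrix.neg_mul, hD]
    simp [Matrix.mul_sub, trace_mul_single, transpose_single]
    ring
  have hnn : 0 ≤ 2 * (((W * H - M) * Hᵀ) i k' - ((W * H - M) * Hᵀ) i k) := by
    refine nonneg_of_forall_small_quadratic_nonneg (c := frobSq (D * H)) hk fun t ht htW => ?_
    have h : frobSq (M - W * H) ≤ frobSq (M - (W + t • D) * H) :=
      hmin _ (hW.transfer i k k' ht.le htW)
    rw [Matrix.add_mul, Matrix.smul_mul, ← sub_sub, frobSq_sub_smul, htr] at h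
    linarith
  linarith

/-- KKT conditions in `W` at a minimizer of mask-NNMF. -/
theorem stmt15 {n N p F K : ℕ} (hN : 1 ≤ N) (hn : N < n) (hF : 1 ≤ F) (hp : F < p)
    (X : Matrix (Fin n) (Fin p) ℝ)
    (W : Matrix (Fin n) (Fin K) ℝ) (H : Matrix (Fin K) (Fin p) ℝ)
    (Nmat : Matrix (Fin n) (Fin p) ℝ)
    (hW : RowStochastic W) (hH : Nonneg H) (hNfeas : maskT n N p F Nmat = X)
    (hmin : ∀ (W' : Matrix (Fin n) (Fin K) ℝ) (H' : Matrix (Fin K) (Fin p) ℝ)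
        (N' : Matrix (Fin n) (Fin p) ℝ),
        RowStochastic W' → Nonneg H' → maskT n N p F N' = X →
        frobSq (Nmat - W * H) ≤ frobSq (N' - W' * H')) :
    ∀ (i : Fin n) (k k' : Fin K),
      (0 < W i k → 0 < W i k' →
        ((W * H - Nmat) * Hᵀ) i k = ((W * H - Nmat) * Hᵀ) i k') ∧
      (0 < W i k → W i k' = 0 →
        ((W * H - Nmat) * Hᵀ) i k ≤ ((W * H - Nmat) * Hᵀ) i k') := by
  have key {i : Fin n} {k : Fin K} (hk : 0 < W i k) (k' : Fin K) :=
    gradient_le_of_isMin hW (fun W' hW' => hmin W' H Nmat hW' hH hNfeas) hk k'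
  exact fun i k k' => ⟨fun hk hk' => (key hk k').antisymm (key hk' k), fun hk _ => key hk k'⟩
end
end
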